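/- arXiv:1102.3201 — 3 statements merged into one kernel-verified Lean document; each statement's English description precedes it below -/
import Mathlib

section
/- Let i₀ ∈ {1,...,d} be an index with c_{i₀,0} ≠ 0. Then for every 0 ≤ m ≤ a_1, the coefficient of the monomial x_{i₀}^m in q_{n,m} equals c_{i₀,0}^m / m! (in particular x_{i₀}^m lies in the support of q_{n,m}), and the total degree of q_{n,m} is exactly m. -/
open MvPolynomial

/-- The polynomial `q_{n,m}` from Section 4 of the paper:
`q_{n,m} = ∑_{τ(γ)=m} (∏_i ∏_j c_{i,j}^{γ_{i,j}} / γ_i!) x_1^{‖γ_1‖₁} ⋯ x_d^{‖γ_d‖₁}`,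
where `τ(γ_1,…,γ_d) = ∑_{j=0}^n a_j ∑_{i=1}^d γ_{i,j}`.  (Since every `a_j ≥ 1`, any `γ`
with `τ(γ) = m` has all entries `≤ m`, so the sum may be taken over entries in
`{0,…,m}`.) -/
noncomputable def qpoly {𝕜 : Type*} [RCLike 𝕜] (d n : ℕ) (a : ℕ → ℕ) (c : Fin d → ℕ → 𝕜)
    (m : ℕ) : MvPolynomial (Fin d) 𝕜 :=
  ∑ γ ∈ (Fintype.piFinset fun _ : Fin d =>
        Fintype.piFinset fun _ : Fin (n + 1) => Finset.range (m + 1)).filter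
      (fun γ => ∑ j : Fin (n + 1), a j.1 * ∑ i, γ i j = m),
    ((∏ i, ∏ j, c i j.1 ^ γ i j) / ((∏ i, ∏ j, Nat.factorial (γ i j) : ℕ) : 𝕜)) •
      ∏ i, X i ^ (∑ j, γ i j)

/-- A strictly decreasing family `a_1 > ⋯ > a_n ≥ 2` has all its terms at least `2`. -/
lemma two_le_of_decreasing {n : ℕ} {a : ℕ → ℕ}
    (hadec : ∀ j, 1 ≤ j → j < n → a (j + 1) < a j) (han : 2 ≤ a n) {j : ℕ}
    (hj : 1 ≤ j) (hjn : j ≤ n) : 2 ≤ a j := by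
  induction hjn using Nat.decreasingInduction with
  | self => exact han
  | of_succ k hk ih => exact (ih (by omega)).trans (hadec k hj hk).le

/-- The monomial with exponent vector `e`, written as a product of powers of the variables. -/
lemma prod_X_pow_eq_monomial_equivFunOnFinite {σ R : Type*} [Fintype σ] [CommSemiring R]
    (e : σ → ℕ) :
    (∏ i, X i ^ e i : MvPolynomial σ R) = monomial (Finsupp.equivFunOnFinite.symm e) 1 := by
  rw [monomial_eq, Finsupp.prod_fintype _ _ (by simp)]
  simp

/-- The sum of all entries is at most the weighted sum of the entries. -/
lemma sum_sum_le_weighted_sum {ι κ : Type*} [Fintype ι] [Fintype κ] {w : κ → ℕ}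
    (hw : ∀ j, 1 ≤ w j) (γ : ι → κ → ℕ) :
    ∑ i, ∑ j, γ i j ≤ ∑ j, w j * ∑ i, γ i j := by
  rw [Finset.sum_comm]
  exact Finset.sum_le_sum fun j _ => Nat.le_mul_of_pos_left _ (hw j)

/-- If the weighted sum of the entries equals their sum, all entries of weight at least `2`
vanish. -/
lemma eq_zero_of_weighted_sum_eq {ι κ : Type*} [Fintype ι] [Fintype κ] {w : κ → ℕ}
    (hw : ∀ j, 1 ≤ w j) {γ : ι → κ → ℕ}
    (h : ∑ j, w j * ∑ i, γ i j = ∑ i, ∑ j, γ i j) {j : κ} (hj : 2 ≤ w j) (i : ι) :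
    γ i j = 0 := by
  rw [Finset.sum_comm (f := γ), eq_comm,
    Finset.sum_eq_sum_iff_of_le fun j _ => Nat.le_mul_of_pos_left _ (hw j)] at h
  have hcol : ∑ i, γ i j = 0 := by
    have := h j (Finset.mem_univ j)
    nlinarith
  exact Finset.sum_eq_zero_iff.mp hcol i (Finset.mem_univ i)

/-- Among the `γ` of weight `m`, only the one concentrated at `(i₀, 0)` contributes the exponent
vector `m • e_{i₀}`. -/
lemma eq_single_of_weighted_sum_eq {ι : Type*} [Fintype ι] [DecidableEq ι] {n m : ℕ}
    {w : Fin (n + 1) → ℕ} (hw : ∀ j, 1 ≤ w j) (hw2 : ∀ j, j ≠ 0 → 2 ≤ w j)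
    {γ : ι → Fin (n + 1) → ℕ} {i₀ : ι} (hτ : ∑ j, w j * ∑ i, γ i j = m)
    (he : ∀ i, ∑ j, γ i j = if i = i₀ then m else 0) :
    γ = fun i j => if i = i₀ ∧ j = 0 then m else 0 := by
  have hzero : ∀ i j, j ≠ 0 → γ i j = 0 := fun i j hj =>
    eq_zero_of_weighted_sum_eq hw (by simp [hτ, he]) (hw2 j hj) i
  funext i j
  by_cases hj : j = 0
  · subst hj
    rw [← Fintype.sum_eq_single (f := γ i) 0 (hzero i), he i]
    simp
  · simp [hj, hzero i j hj]

/-- if `c_{i₀,0} ≠ 0` then for `0 ≤ m ≤ a_1` the coefficient of `x_{i₀}^m`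
in `q_{n,m}` equals `c_{i₀,0}^m / m!` (in particular `x_{i₀}^m` lies in the support of
`q_{n,m}`), and the total degree of `q_{n,m}` is exactly `m`. -/
theorem qpoly_coeff_and_totalDegree {𝕜 : Type*} [RCLike 𝕜] (d n : ℕ)
    (hd : 1 ≤ d) (hn : 1 ≤ n) (a : ℕ → ℕ) (c : Fin d → ℕ → 𝕜)
    (ha0 : a 0 = 1) (hadec : ∀ j, 1 ≤ j → j < n → a (j + 1) < a j) (han : 2 ≤ a n)
    (hc : ∃ i : Fin d, c i 0 ≠ 0)
    (i₀ : Fin d) (hi₀ : c i₀ 0 ≠ 0) (m : ℕ) (hm : m ≤ a 1) :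
    MvPolynomial.coeff (Finsupp.single i₀ m) (qpoly d n a c m)
        = c i₀ 0 ^ m / (m.factorial : 𝕜) ∧
      Finsupp.single i₀ m ∈ (qpoly d n a c m).support ∧
      (qpoly d n a c m).totalDegree = m := by
  have ha2 : ∀ j : Fin (n + 1), j ≠ 0 → 2 ≤ a j := fun j hj =>
    two_le_of_decreasing hadec han (Nat.one_le_iff_ne_zero.mpr (Fin.val_ne_zero_iff.mpr hj))
      (Nat.lt_succ_iff.mp j.2)
  have ha1 : ∀ j : Fin (n + 1), 1 ≤ a j := fun j => by
    by_cases hj : j = 0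
    · simp [hj, ha0]
    · exact one_le_two.trans (ha2 j hj)
  have hcoeff : MvPolynomial.coeff (Finsupp.single i₀ m) (qpoly d n a c m)
      = c i₀ 0 ^ m / (m.factorial : 𝕜) := by
    simp only [qpoly, prod_X_pow_eq_monomial_equivFunOnFinite, coeff_sum, coeff_smul,
      coeff_monomial]
    rw [Finset.sum_eq_single fun i j => if i = i₀ ∧ j = 0 then m else 0]
    · rw [if_pos]
      · have hnum : ∏ i, ∏ j : Fin (n + 1), c i j.1 ^ (if i = i₀ ∧ j = 0 then m else 0)
            = c i₀ 0 ^ m := by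
          rw [Fintype.prod_eq_single i₀ fun i hi => by simp [hi],
            Fintype.prod_eq_single 0 fun j hj => by simp [hj]]
          simp
        have hden : ∏ i, ∏ j : Fin (n + 1), (if i = i₀ ∧ j = 0 then m else 0).factorial
            = m.factorial := by
          rw [Fintype.prod_eq_single i₀ fun i hi => by simp [hi],
            Fintype.prod_eq_single 0 fun j hj => by simp [hj]]
          simp
        rw [hnum, hden, smul_eq_mul, mul_one]
      · ext i
        by_cases hi : i = i₀
        · simp [hi]
        · simp [hi]
    · intro γ hγ hne
      rw [if_neg, smul_zero]
      intro he
      refine hne (eq_single_of_weighted_sum_eq ha1 ha2 (Finset.mem_filter.mp hγ).2 fun i => ?_)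
      simpa [Finsupp.single_apply, eq_comm] using DFunLike.congr_fun he i
    · refine fun hnot => (hnot ?_).elim
      simp only [Finset.mem_filter, Fintype.mem_piFinset, Finset.mem_range]
      refine ⟨fun i j => by split_ifs <;> omega, ?_⟩
      rw [Fintype.sum_eq_single 0 fun j hj => by simp [hj]]
      simp [ha0]
  have hsupp : Finsupp.single i₀ m ∈ (qpoly d n a c m).support := by
    rw [mem_support_iff, hcoeff]
    exact div_ne_zero (pow_ne_zero m hi₀) (Nat.cast_ne_zero.mpr m.factorial_ne_zero)
  refine ⟨hcoeff, hsupp, le_antisymm ?_ ?_⟩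
  · refine totalDegree_finsetSum_le fun γ hγ => (totalDegree_smul_le _ _).trans ?_
    rw [prod_X_pow_eq_monomial_equivFunOnFinite, totalDegree_monomial _ one_ne_zero,
      Finsupp.sum_fintype _ _ fun _ => rfl]
    exact (sum_sum_le_weighted_sum ha1 γ).trans (Finset.mem_filter.mp hγ).2.le
  · simpa using le_totalDegree hsupp
end

section
/- The subspace Q = span_𝔽 { q_{n,m} : 0 ≤ m ≤ a_1 } of 𝔽[x_1,...,x_d] is D-invariant; that is, for every q ∈ Q and every i ∈ {1,...,d}, the partial derivative ∂q/∂x_i belongs to Q. -/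
open MvPolynomial

/-- The coefficient of the monomial of `qpoly` indexed by `γ`. -/
noncomputable def qcoeff {𝕜 : Type*} [RCLike 𝕜] {d n : ℕ} (c : Fin d → ℕ → 𝕜)
    (γ : Fin d → Fin (n + 1) → ℕ) : 𝕜 :=
  ∏ i, ∏ j, c i j.1 ^ γ i j / (Nat.factorial (γ i j) : 𝕜)

/-- The exponent of the monomial of `qpoly` indexed by `γ`. -/
noncomputable def qexp {d n : ℕ} (γ : Fin d → Fin (n + 1) → ℕ) : Fin d →₀ ℕ :=
  Finsupp.equivFunOnFinite.symm fun i => ∑ j, γ i j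

/-- The weight `τ(γ)`. -/
def qweight {d n : ℕ} (a : ℕ → ℕ) (γ : Fin d → Fin (n + 1) → ℕ) : ℕ :=
  ∑ j : Fin (n + 1), a j.1 * ∑ i, γ i j

/-- The multi-index with a single entry `1` at position `(i, j)`. -/
def qunit {d n : ℕ} (i : Fin d) (j : Fin (n + 1)) : Fin d → Fin (n + 1) → ℕ :=
  Pi.single i (Pi.single j 1)

/-- The multi-indices of weight `m` that occur in `qpoly`. -/
def qindex (d n : ℕ) (a : ℕ → ℕ) (m : ℕ) : Finset (Fin d → Fin (n + 1) → ℕ) :=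
  (Fintype.piFinset fun _ : Fin d =>
    Fintype.piFinset fun _ : Fin (n + 1) => Finset.range (m + 1)).filter
      (fun γ => qweight a γ = m)

theorem mem_qindex {d n : ℕ} {a : ℕ → ℕ} (ha : ∀ j ≤ n, 1 ≤ a j) {m : ℕ}
    {γ : Fin d → Fin (n + 1) → ℕ} : γ ∈ qindex d n a m ↔ qweight a γ = m := by
  simp only [qindex, Finset.mem_filter, Fintype.mem_piFinset, Finset.mem_range,
    and_iff_right_iff_imp]
  rintro rfl i j
  have h₁ : γ i j ≤ ∑ i, γ i j :=
    Finset.single_le_sum (f := fun i => γ i j) (fun _ _ => Nat.zero_le _) (Finset.mem_univ i)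
  have h₂ : a j.1 * ∑ i, γ i j ≤ qweight a γ :=
    Finset.single_le_sum (f := fun j : Fin (n + 1) => a j.1 * ∑ i, γ i j)
      (fun _ _ => Nat.zero_le _) (Finset.mem_univ j)
  have h₃ := Nat.le_mul_of_pos_left (∑ i, γ i j) (ha j.1 (Nat.lt_succ_iff.mp j.2))
  omega

theorem qpoly_eq_sum_monomial {𝕜 : Type*} [RCLike 𝕜] (d n : ℕ) (a : ℕ → ℕ)
    (c : Fin d → ℕ → 𝕜) (m : ℕ) :
    qpoly d n a c m = ∑ γ ∈ qindex d n a m, monomial (qexp γ) (qcoeff c γ) := by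
  refine Finset.sum_congr rfl fun γ _ => ?_
  rw [monomial_eq, ← smul_eq_C_mul, Finsupp.prod_fintype _ _ (by simp)]
  simp [qcoeff, qexp, Finset.prod_div_distrib]

theorem qweight_add_qunit {d n : ℕ} (a : ℕ → ℕ) (γ : Fin d → Fin (n + 1) → ℕ)
    (i : Fin d) (j : Fin (n + 1)) : qweight a (γ + qunit i j) = qweight a γ + a j.1 := by
  have h (k : Fin (n + 1)) : ∑ l, qunit i j l k = if k = j then 1 else 0 := by
    rw [Finset.sum_eq_single i]
    · simp [qunit, Pi.single_apply]
    · intro l _ hl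
      simp [qunit, hl]
    · simp
  simp [qweight, Finset.sum_add_distrib, mul_add, h]

theorem qexp_add_qunit {d n : ℕ} (γ : Fin d → Fin (n + 1) → ℕ) (i : Fin d)
    (j : Fin (n + 1)) : qexp (γ + qunit i j) = qexp γ + Finsupp.single i 1 := by
  ext l
  by_cases hl : l = i
  · subst hl
    simp [qexp, qunit, Finset.sum_add_distrib]
  · simp [qexp, qunit, hl]

theorem Fintype.prod_mul_eq_mul_prod {ι R : Type*} [Fintype ι] [DecidableEq ι] [CommMonoid R]
    {f g : ι → R} {u v : R} (i : ι) (hne : ∀ k, k ≠ i → f k = g k) (hi : f i * u = v * g i) :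
    (∏ k, f k) * u = v * ∏ k, g k := by
  rw [← Finset.mul_prod_erase _ f (Finset.mem_univ i),
    ← Finset.mul_prod_erase _ g (Finset.mem_univ i), mul_right_comm, hi, mul_assoc,
    Finset.prod_congr rfl fun k hk => hne k (Finset.ne_of_mem_erase hk)]

theorem qcoeff_add_qunit {𝕜 : Type*} [RCLike 𝕜] {d n : ℕ} (c : Fin d → ℕ → 𝕜)
    (γ : Fin d → Fin (n + 1) → ℕ) (i : Fin d) (j : Fin (n + 1)) :
    qcoeff c (γ + qunit i j) * ((γ i j + 1 : ℕ) : 𝕜) = c i j.1 * qcoeff c γ := by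
  refine Fintype.prod_mul_eq_mul_prod i (fun k hk => by simp [qunit, hk]) ?_
  refine Fintype.prod_mul_eq_mul_prod j (fun k hk => by simp [qunit, hk]) ?_
  have h₁ : ((γ i j + 1 : ℕ) : 𝕜) ≠ 0 := Nat.cast_ne_zero.mpr (Nat.succ_ne_zero _)
  have h₂ : (Nat.factorial (γ i j) : 𝕜) ≠ 0 := Nat.cast_ne_zero.mpr (Nat.factorial_ne_zero _)
  have h₃ : (γ + qunit i j) i j = γ i j + 1 := by simp [qunit]
  rw [h₃, Nat.factorial_succ, Nat.cast_mul, pow_succ]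
  field_simp

theorem sub_qunit_add_qunit {d n : ℕ} {γ : Fin d → Fin (n + 1) → ℕ} {i : Fin d}
    {j : Fin (n + 1)} (h : γ i j ≠ 0) : γ - qunit i j + qunit i j = γ := by
  refine tsub_add_cancel_of_le fun k l => ?_
  by_cases hk : k = i
  · subst hk
    by_cases hl : l = j
    · subst hl
      simpa [qunit] using Nat.one_le_iff_ne_zero.mpr h
    · simp [qunit, hl]
  · simp [qunit, hk]

/-- Terms of `∂q_{n,m}/∂x_i` that come from lowering the `(i, j)` entry of the index. -/
theorem sum_monomial_qindex {𝕜 : Type*} [RCLike 𝕜] {d n : ℕ} {a : ℕ → ℕ}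
    (c : Fin d → ℕ → 𝕜) (ha : ∀ j ≤ n, 1 ≤ a j) (m : ℕ) (i : Fin d) (j : Fin (n + 1)) :
    ∑ γ ∈ qindex d n a m, monomial (qexp γ - Finsupp.single i 1) (qcoeff c γ * (γ i j : 𝕜)) =
      if a j.1 ≤ m then c i j.1 • qpoly d n a c (m - a j.1) else 0 := by
  rw [← Finset.sum_filter_of_ne (p := fun γ => γ i j ≠ 0)
    (fun γ _ hγ h => hγ (by simp [h]))]
  split_ifs with hm
  · rw [qpoly_eq_sum_monomial, Finset.smul_sum]
    symm
    refine Finset.sum_nbij' (fun γ => γ + qunit i j) (fun γ => γ - qunit i j) ?_ ?_ ?_ ?_ ?_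
    · intro γ hγ
      rw [mem_qindex ha] at hγ
      rw [Finset.mem_filter, mem_qindex ha, qweight_add_qunit]
      exact ⟨by omega, by simp [qunit]⟩
    · intro γ hγ
      rw [Finset.mem_filter, mem_qindex ha] at hγ
      have h := qweight_add_qunit a (γ - qunit i j) i j
      rw [sub_qunit_add_qunit hγ.2] at h
      rw [mem_qindex ha]
      omega
    · intro γ _
      exact add_tsub_cancel_right γ _
    · intro γ hγ
      exact sub_qunit_add_qunit (Finset.mem_filter.mp hγ).2
    · intro γ _
      have h : (γ + qunit i j) i j = γ i j + 1 := by simp [qunit]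
      rw [h, qcoeff_add_qunit, qexp_add_qunit, add_tsub_cancel_right, smul_monomial, smul_eq_mul]
  · refine Finset.sum_eq_zero fun γ hγ => ?_
    rw [Finset.mem_filter, mem_qindex ha] at hγ
    have h := qweight_add_qunit a (γ - qunit i j) i j
    rw [sub_qunit_add_qunit hγ.2] at h
    omega

theorem pderiv_qpoly {𝕜 : Type*} [RCLike 𝕜] {d n : ℕ} {a : ℕ → ℕ}
    (c : Fin d → ℕ → 𝕜) (ha : ∀ j ≤ n, 1 ≤ a j) (m : ℕ) (i : Fin d) :
    pderiv i (qpoly d n a c m) =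
      ∑ j : Fin (n + 1), if a j.1 ≤ m then c i j.1 • qpoly d n a c (m - a j.1) else 0 := by
  simp_rw [← sum_monomial_qindex c ha m i]
  rw [Finset.sum_comm, qpoly_eq_sum_monomial, map_sum]
  refine Finset.sum_congr rfl fun γ _ => ?_
  rw [pderiv_monomial, ← map_sum, ← Finset.mul_sum]
  simp [qexp]

/-- the subspace `Q = span{q_{n,m} : 0 ≤ m ≤ a_1}` is D-invariant: it is
closed under every partial differentiation `∂/∂x_i`. -/
theorem span_qpoly_D_invariant {𝕜 : Type*} [RCLike 𝕜] (d n : ℕ)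
    (hd : 1 ≤ d) (hn : 1 ≤ n) (a : ℕ → ℕ) (c : Fin d → ℕ → 𝕜)
    (ha0 : a 0 = 1) (hadec : ∀ j, 1 ≤ j → j < n → a (j + 1) < a j) (han : 2 ≤ a n)
    (hc : ∃ i : Fin d, c i 0 ≠ 0) :
    ∀ q ∈ Submodule.span 𝕜
        {p : MvPolynomial (Fin d) 𝕜 | ∃ m ≤ a 1, p = qpoly d n a c m},
      ∀ i : Fin d,
        pderiv i q ∈ Submodule.span 𝕜
          {p : MvPolynomial (Fin d) 𝕜 | ∃ m ≤ a 1, p = qpoly d n a c m} := by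
  have ha : ∀ j ≤ n, 1 ≤ a j := by
    intro j hj
    rcases Nat.eq_zero_or_pos j with rfl | hj0
    · exact ha0.ge
    · induction hj using Nat.decreasingInduction with
      | self => omega
      | of_succ k hk ih => exact (ih k.succ_pos).trans (hadec k hj0 hk).le
  intro q hq i
  induction hq using Submodule.span_induction with
  | mem p hp =>
    obtain ⟨m, hm, rfl⟩ := hp
    rw [pderiv_qpoly c ha]
    refine Submodule.sum_mem _ fun j _ => ?_
    split_ifs
    · exact Submodule.smul_mem _ _ (Submodule.subset_span ⟨_, (Nat.sub_le _ _).trans hm, rfl⟩)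
    · exact Submodule.zero_mem _
  | zero => simp
  | add p q _ _ hp hq => simpa using Submodule.add_mem _ hp hq
  | smul r p _ hp => simpa using Submodule.smul_mem _ r hp
end

section
/- With the data below, let Λ and V be as described, let η > 0 be such that for all 0 < |h| < η the perturbed Lagrange interpolation problem from V is uniquely solvable, and define: P f = the unique g ∈ V with λ(g) = λ(f) for all λ ∈ Λ; and for 0 < |h| < η, P_h f = the unique g ∈ V with g = f at all the perturbed points ξ^{(k)} + h·Σ_{i=1}^d α_i ρ_i^{(k)} (1 ≤ k ≤ μ, α ∈ Δ^{(k)}) and ξ^{(μ+l)} + φ^{(l)}(mh) (1 ≤ l ≤ ν, 0 ≤ m ≤ a_1^{(l)}). Then P is the pointwise limit of P_h as h → 0: for every f ∈ 𝔽[x_1,...,x_d] and every multi-index β ∈ ℕ^d, the coefficient of x^β in P_h f tends to the coefficient of x^β in P f as h → 0 (h ranging over 0 < |h| < η). -/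
open MvPolynomial

/-- The directional derivative operator `D_ρ f = ∑ i ρ_i ∂f/∂x_i`. -/
noncomputable def dirDeriv {𝕜 : Type*} [RCLike 𝕜] {d : ℕ} (ρ : Fin d → 𝕜) :
    Module.End 𝕜 (MvPolynomial (Fin d) 𝕜) :=
  ∑ i, ρ i • (pderiv i).toLinearMap

/-- The composed directional derivative `D_ρ^α = D_{ρ_1}^{α_1} ∘ ⋯ ∘ D_{ρ_d}^{α_d}`. -/
noncomputable def dirDerivMulti {𝕜 : Type*} [RCLike 𝕜] {d : ℕ}
    (ρ : Fin d → (Fin d → 𝕜)) (α : Fin d → ℕ) :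
    Module.End 𝕜 (MvPolynomial (Fin d) 𝕜) :=
  (List.ofFn fun i => (dirDeriv (ρ i)) ^ α i).prod

/-- The differential operator `∂^{‖β‖₁}/∂x_1^{β_1}⋯∂x_d^{β_d}`. -/
noncomputable def DMulti {𝕜 : Type*} [RCLike 𝕜] {d : ℕ} (β : Fin d → ℕ) :
    Module.End 𝕜 (MvPolynomial (Fin d) 𝕜) :=
  (List.ofFn fun i =>
    ((pderiv i).toLinearMap : Module.End 𝕜 (MvPolynomial (Fin d) 𝕜)) ^ β i).prod

/-- For a polynomial `q = ∑_β q̂(β) x^β`, the associated differential operator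
`q(D) : f ↦ ∑_β q̂(β) ∂^{‖β‖₁} f / ∂x^β`. -/
noncomputable def polyD {𝕜 : Type*} [RCLike 𝕜] {d : ℕ} (q : MvPolynomial (Fin d) 𝕜) :
    Module.End 𝕜 (MvPolynomial (Fin d) 𝕜) :=
  ∑ β ∈ q.support, q.coeff β • DMulti (fun i => β i)

/-- The weight of the `k`-th node in the `m`-th forward difference. -/
def fwdWeight (𝕜 : Type*) [Ring 𝕜] (m k : ℕ) : 𝕜 := (-1) ^ (m - k) * (m.choose k : 𝕜)

theorem sum_fwdWeight_mul_pow_of_lt {𝕜 : Type*} [CommRing 𝕜] {m n : ℕ} (h : n < m) :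
    ∑ k ∈ Finset.range (m + 1), fwdWeight 𝕜 m k * (k : 𝕜) ^ n = 0 := by
  have := congrFun (fwdDiff_iter_pow_eq_zero_of_lt (R := 𝕜) h) 0
  rw [fwdDiff_iter_eq_sum_shift] at this
  simpa [fwdWeight, zsmul_eq_mul] using this

theorem sum_fwdWeight_mul_pow_self {𝕜 : Type*} [CommRing 𝕜] (m : ℕ) :
    ∑ k ∈ Finset.range (m + 1), fwdWeight 𝕜 m k * (k : 𝕜) ^ m = (m.factorial : 𝕜) := by
  have := congrFun (fwdDiff_iter_eq_factorial (R := 𝕜) (n := m)) 0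
  rw [fwdDiff_iter_eq_sum_shift] at this
  simpa [fwdWeight, zsmul_eq_mul] using this

theorem tendsto_inv_pow_mul_mul_pow {𝕜 : Type*} [RCLike 𝕜] {m n : ℕ} {s : 𝕜}
    (hs : n < m → s = 0) :
    Filter.Tendsto (fun h : 𝕜 => (h ^ m)⁻¹ * (s * h ^ n)) (nhdsWithin 0 {0}ᶜ)
      (nhds (if n = m then s else 0)) := by
  rcases lt_trichotomy n m with h | rfl | h
  · simp [hs h]
  · refine tendsto_const_nhds.congr' ?_
    filter_upwards [self_mem_nhdsWithin] with x hx
    have : x ≠ 0 := hx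
    simp only [if_true]
    field_simp
  · obtain ⟨k, rfl⟩ := Nat.exists_eq_add_of_lt h
    have h0 : Filter.Tendsto (fun x : 𝕜 => s * x ^ (k + 1)) (nhdsWithin 0 {0}ᶜ) (nhds 0) := by
      have : Continuous fun x : 𝕜 => s * x ^ (k + 1) := by fun_prop
      simpa using (this.tendsto 0).mono_left nhdsWithin_le_nhds
    rw [if_neg h.ne']
    refine h0.congr' ?_
    filter_upwards [self_mem_nhdsWithin] with x hx
    have : x ≠ 0 := hx
    field_simp
    ring

theorem Polynomial.tendsto_fwdWeight_sum {𝕜 : Type*} [RCLike 𝕜] (p : Polynomial 𝕜) (m : ℕ) :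
    Filter.Tendsto (fun h : 𝕜 => (h ^ m)⁻¹ *
        ∑ k ∈ Finset.range (m + 1), fwdWeight 𝕜 m k * p.eval ((k : 𝕜) * h))
      (nhdsWithin 0 {0}ᶜ) (nhds (m.factorial * p.coeff m)) := by
  have hexp : ∀ h : 𝕜, (h ^ m)⁻¹ *
        ∑ k ∈ Finset.range (m + 1), fwdWeight 𝕜 m k * p.eval ((k : 𝕜) * h) =
      ∑ n ∈ p.support, p.coeff n * ((h ^ m)⁻¹ *
        ((∑ k ∈ Finset.range (m + 1), fwdWeight 𝕜 m k * (k : 𝕜) ^ n) * h ^ n)) := by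
    intro h
    simp only [Polynomial.eval_eq_sum, Polynomial.sum, Finset.mul_sum, Finset.sum_mul]
    rw [Finset.sum_comm]
    refine Finset.sum_congr rfl fun n _ => Finset.sum_congr rfl fun k _ => ?_
    ring
  simp only [hexp]
  have hlim : (m.factorial * p.coeff m : 𝕜) = ∑ n ∈ p.support, p.coeff n *
      (if n = m then ∑ k ∈ Finset.range (m + 1), fwdWeight 𝕜 m k * (k : 𝕜) ^ n else 0) := by
    simp only [mul_ite, mul_zero, Finset.sum_ite_eq', sum_fwdWeight_mul_pow_self]
    split_ifs with hm
    · ring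
    · simp [Polynomial.notMem_support_iff.mp hm]
  rw [hlim]
  exact tendsto_finsetSum _ fun n _ =>
    (tendsto_inv_pow_mul_mul_pow sum_fwdWeight_mul_pow_of_lt).const_mul _

theorem MvPolynomial.tendsto_fwdWeight_sum {𝕜 ι : Type*} [RCLike 𝕜] [Fintype ι] [DecidableEq ι]
    (F : MvPolynomial ι 𝕜) (α : ι → ℕ) :
    Filter.Tendsto (fun h : 𝕜 => (h ^ (∑ i, α i))⁻¹ *
        ∑ β ∈ Fintype.piFinset fun i => Finset.range (α i + 1),
          (∏ i, fwdWeight 𝕜 (α i) (β i)) * eval (fun i => h * (β i : 𝕜)) F)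
      (nhdsWithin 0 {0}ᶜ)
      (nhds ((∏ i, ((α i).factorial : 𝕜)) * F.coeff (Finsupp.equivFunOnFinite.symm α))) := by
  set S : (ι →₀ ℕ) → 𝕜 := fun γ =>
    ∏ i, ∑ k ∈ Finset.range (α i + 1), fwdWeight 𝕜 (α i) k * (k : 𝕜) ^ γ i with hS
  have hexp : ∀ h : 𝕜, (h ^ (∑ i, α i))⁻¹ *
        ∑ β ∈ Fintype.piFinset fun i => Finset.range (α i + 1),
          (∏ i, fwdWeight 𝕜 (α i) (β i)) * eval (fun i => h * (β i : 𝕜)) F =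
      ∑ γ ∈ F.support, F.coeff γ * ((h ^ (∑ i, α i))⁻¹ * (S γ * h ^ (∑ i, γ i))) := by
    intro h
    simp only [hS, Finset.prod_univ_sum, eval_eq', Finset.mul_sum, Finset.sum_mul]
    rw [Finset.sum_comm]
    refine Finset.sum_congr rfl fun γ _ => Finset.sum_congr rfl fun β _ => ?_
    simp only [mul_pow, Finset.prod_mul_distrib, Finset.prod_pow_eq_pow_sum]
    ring
  have hzero : ∀ γ : ι →₀ ℕ, (∃ i, γ i < α i) → S γ = 0 := fun γ ⟨i, hi⟩ =>
    Finset.prod_eq_zero (Finset.mem_univ i) (sum_fwdWeight_mul_pow_of_lt hi)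
  have hlt : ∀ γ : ι →₀ ℕ, ∑ i, γ i < ∑ i, α i → S γ = 0 := fun γ h => by
    obtain ⟨i, -, hi⟩ := Finset.exists_lt_of_sum_lt h
    exact hzero γ ⟨i, hi⟩
  have hite : ∀ γ : ι →₀ ℕ, (if ∑ i, γ i = ∑ i, α i then S γ else 0) =
      if γ = Finsupp.equivFunOnFinite.symm α then ∏ i, ((α i).factorial : 𝕜) else 0 := by
    intro γ
    by_cases hγ : γ = Finsupp.equivFunOnFinite.symm α
    · subst hγ
      simp [hS, sum_fwdWeight_mul_pow_self]
    · rw [if_neg hγ]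
      split_ifs with hsum
      · refine hzero γ ?_
        by_contra! hle
        refine hγ (Finsupp.ext fun i => ?_)
        exact ((Finset.sum_eq_sum_iff_of_le fun i _ => hle i).mp hsum.symm i
          (Finset.mem_univ i)).symm
      · rfl
  simp only [hexp]
  have hlim : (∏ i, ((α i).factorial : 𝕜)) * F.coeff (Finsupp.equivFunOnFinite.symm α) =
      ∑ γ ∈ F.support, F.coeff γ * (if ∑ i, γ i = ∑ i, α i then S γ else 0) := by
    simp only [hite, mul_ite, mul_zero, Finset.sum_ite_eq']
    split_ifs with hm
    · ring
    · simp [notMem_support_iff.mp hm]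
  rw [hlim]
  exact tendsto_finsetSum _ fun γ _ => (tendsto_inv_pow_mul_mul_pow (hlt γ)).const_mul _

theorem MvPolynomial.coeff_pderiv_pow {𝕜 ι : Type*} [CommRing 𝕜] {i : ι} (k : ℕ)
    (p : MvPolynomial ι 𝕜) {m : ι →₀ ℕ} (hm : m i = 0) :
    coeff m (((pderiv i).toLinearMap ^ k : Module.End 𝕜 (MvPolynomial ι 𝕜)) p) =
      k.factorial * coeff (m + Finsupp.single i k) p := by
  induction k generalizing p with
  | zero => simp
  | succ k ih =>
    rw [pow_succ, Module.End.mul_apply, ih, Derivation.coeFn_coe, coeff_pderiv, add_assoc,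
      ← Finsupp.single_add, Nat.factorial_succ]
    simp [hm]
    ring

theorem MvPolynomial.coeff_list_prod_pderiv_pow {𝕜 ι : Type*} [CommRing 𝕜] (α : ι → ℕ)
    (l : List ι) (hl : l.Nodup) (p : MvPolynomial ι 𝕜) (m : ι →₀ ℕ) (hm : ∀ i ∈ l, m i = 0) :
    coeff m ((l.map fun i =>
        ((pderiv i).toLinearMap ^ α i : Module.End 𝕜 (MvPolynomial ι 𝕜))).prod p) =
      (l.map fun i => ((α i).factorial : 𝕜)).prod *
        coeff (m + (l.map fun i => Finsupp.single i (α i)).sum) p := by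
  induction l generalizing m with
  | nil => simp
  | cons i l ih =>
    obtain ⟨hi, hl⟩ := List.nodup_cons.mp hl
    simp only [List.map_cons, List.prod_cons, List.sum_cons, Module.End.mul_apply]
    rw [coeff_pderiv_pow _ _ (hm i List.mem_cons_self), ih hl]
    · rw [add_assoc, mul_assoc]
    · intro j hj
      have : i ≠ j := fun h => hi (h ▸ hj)
      simp [hm j (List.mem_cons_of_mem _ hj), this]

theorem coeff_zero_DMulti {𝕜 : Type*} [RCLike 𝕜] {d : ℕ} (α : Fin d → ℕ)
    (p : MvPolynomial (Fin d) 𝕜) :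
    coeff 0 (DMulti α p) =
      (∏ i, ((α i).factorial : 𝕜)) * p.coeff (Finsupp.equivFunOnFinite.symm α) := by
  rw [DMulti, List.ofFn_eq_map,
    coeff_list_prod_pderiv_pow α _ (List.nodup_finRange d) p 0 (by simp)]
  rw [← List.ofFn_eq_map, ← List.ofFn_eq_map, List.prod_ofFn, List.sum_ofFn, zero_add]
  congr 2
  ext i
  simp [Finsupp.finsetSum_apply, Finsupp.single_apply]

/-- The substitution `f ↦ f (ξ + ∑ i, y_i ρ_i)` in new coordinates `y`. -/
noncomputable def affineSubst {𝕜 : Type*} [CommRing 𝕜] {d : ℕ} (ξ : Fin d → 𝕜)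
    (ρ : Fin d → Fin d → 𝕜) : MvPolynomial (Fin d) 𝕜 →ₐ[𝕜] MvPolynomial (Fin d) 𝕜 :=
  aeval fun j => C (ξ j) + ∑ i, X i * C (ρ i j)

theorem eval_affineSubst {𝕜 : Type*} [CommRing 𝕜] {d : ℕ} (ξ y : Fin d → 𝕜)
    (ρ : Fin d → Fin d → 𝕜) (f : MvPolynomial (Fin d) 𝕜) :
    eval y (affineSubst ξ ρ f) = eval (fun j => ξ j + ∑ i, y i * ρ i j) f := by
  induction f using MvPolynomial.induction_on with
  | C a => simp [affineSubst]
  | add p q hp hq => simp [hp, hq]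
  | mul_X p j hp => rw [map_mul, map_mul, hp, map_mul]; simp [affineSubst]

theorem dirDeriv_apply {𝕜 : Type*} [RCLike 𝕜] {d : ℕ} (ρ : Fin d → 𝕜)
    (f : MvPolynomial (Fin d) 𝕜) : dirDeriv ρ f = ∑ i, ρ i • pderiv i f := by
  simp [dirDeriv, LinearMap.sum_apply]

theorem pderiv_affineSubst {𝕜 : Type*} [RCLike 𝕜] {d : ℕ} (ξ : Fin d → 𝕜)
    (ρ : Fin d → Fin d → 𝕜) (i : Fin d) (f : MvPolynomial (Fin d) 𝕜) :
    pderiv i (affineSubst ξ ρ f) = affineSubst ξ ρ (dirDeriv (ρ i) f) := by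
  induction f using MvPolynomial.induction_on with
  | C a => simp [affineSubst, dirDeriv_apply]
  | add p q hp hq => simp [hp, hq]
  | mul_X p j hp =>
    have hX : dirDeriv (ρ i) (X j : MvPolynomial (Fin d) 𝕜) = C (ρ i j) := by
      simp [dirDeriv_apply, pderiv_X, Pi.single_apply, smul_eq_C_mul]
    have hmul : dirDeriv (ρ i) (p * X j) = dirDeriv (ρ i) p * X j + p * dirDeriv (ρ i) (X j) := by
      simp only [dirDeriv_apply, pderiv_mul, smul_add, Finset.sum_add_distrib, Finset.sum_mul,
        Finset.mul_sum, smul_mul_assoc, mul_smul_comm]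
    have hXs : pderiv i (affineSubst ξ ρ (X j)) = C (ρ i j) := by
      simp [affineSubst, pderiv_X, Pi.single_apply]
    rw [map_mul, pderiv_mul, hp, hXs, hmul, hX, map_add, map_mul, map_mul]
    simp [affineSubst]

theorem DMulti_affineSubst {𝕜 : Type*} [RCLike 𝕜] {d : ℕ} (ξ : Fin d → 𝕜)
    (ρ : Fin d → Fin d → 𝕜) (α : Fin d → ℕ) (f : MvPolynomial (Fin d) 𝕜) :
    DMulti α (affineSubst ξ ρ f) = affineSubst ξ ρ (dirDerivMulti ρ α f) := by
  have hpow : ∀ i k (f : MvPolynomial (Fin d) 𝕜),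
      ((pderiv i).toLinearMap ^ k : Module.End 𝕜 (MvPolynomial (Fin d) 𝕜)) (affineSubst ξ ρ f) =
        affineSubst ξ ρ ((dirDeriv (ρ i) ^ k) f) := by
    intro i k
    induction k with
    | zero => simp
    | succ k ih =>
      intro f
      rw [pow_succ, pow_succ, Module.End.mul_apply, Module.End.mul_apply, ← ih]
      simp [pderiv_affineSubst]
  rw [DMulti, dirDerivMulti, List.ofFn_eq_map, List.ofFn_eq_map]
  induction List.finRange d with
  | nil => simp
  | cons i l ih =>
    simp only [List.map_cons, List.prod_cons, Module.End.mul_apply, ih, hpow]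

theorem eval_dirDerivMulti {𝕜 : Type*} [RCLike 𝕜] {d : ℕ} (ξ : Fin d → 𝕜)
    (ρ : Fin d → Fin d → 𝕜) (α : Fin d → ℕ) (f : MvPolynomial (Fin d) 𝕜) :
    eval ξ (dirDerivMulti ρ α f) = (∏ i, ((α i).factorial : 𝕜)) *
      (affineSubst ξ ρ f).coeff (Finsupp.equivFunOnFinite.symm α) := by
  rw [← coeff_zero_DMulti, DMulti_affineSubst, ← constantCoeff_eq, ← eval_zero, eval_affineSubst]
  simp

theorem tendsto_dirDerivMulti {𝕜 : Type*} [RCLike 𝕜] {d : ℕ} (ξ : Fin d → 𝕜)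
    (ρ : Fin d → Fin d → 𝕜) (α : Fin d → ℕ) (f : MvPolynomial (Fin d) 𝕜) :
    Filter.Tendsto (fun h : 𝕜 => (h ^ (∑ i, α i))⁻¹ *
        ∑ β ∈ Fintype.piFinset fun i => Finset.range (α i + 1),
          (∏ i, fwdWeight 𝕜 (α i) (β i)) *
            eval (fun j => ξ j + h * ∑ i, (β i : 𝕜) * ρ i j) f)
      (nhdsWithin 0 {0}ᶜ) (nhds (eval ξ (dirDerivMulti ρ α f))) := by
  have h := MvPolynomial.tendsto_fwdWeight_sum (affineSubst ξ ρ f) α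
  simpa only [eval_affineSubst, mul_assoc, ← Finset.mul_sum, ← eval_dirDerivMulti] using h

theorem coeff_qpoly {𝕜 : Type*} [RCLike 𝕜] (d n : ℕ) (a : ℕ → ℕ) (c : Fin d → ℕ → 𝕜) (m : ℕ)
    (β : Fin d →₀ ℕ) :
    (qpoly d n a c m).coeff β =
      ∑ γ ∈ (Fintype.piFinset fun _ : Fin d =>
          Fintype.piFinset fun _ : Fin (n + 1) => Finset.range (m + 1)).filter
        (fun γ => (∑ j : Fin (n + 1), a j.1 * ∑ i, γ i j = m) ∧ ∀ i, ∑ j, γ i j = β i),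
      (∏ i, ∏ j, c i j.1 ^ γ i j) / ((∏ i, ∏ j, Nat.factorial (γ i j) : ℕ) : 𝕜) := by
  rw [qpoly, coeff_sum, ← Finset.filter_filter, Finset.sum_filter (p := fun γ => ∀ i, _ = _)]
  refine Finset.sum_congr rfl fun γ _ => ?_
  have hmon : (∏ i, X i ^ (∑ j, γ i j) : MvPolynomial (Fin d) 𝕜) =
      monomial (Finsupp.equivFunOnFinite.symm fun i => ∑ j, γ i j) 1 := by
    rw [monomial_eq, Finsupp.prod_fintype _ _ (by simp)]
    simp
  rw [hmon, coeff_smul, coeff_monomial, smul_eq_mul, mul_ite, mul_one, mul_zero]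
  refine if_congr ?_ rfl rfl
  rw [Finsupp.ext_iff]
  rfl

theorem coeff_curve_prod_pow {𝕜 : Type*} [RCLike 𝕜] {d n : ℕ} {a : ℕ → ℕ}
    (ha : ∀ j ≤ n, 1 ≤ a j) (c : Fin d → ℕ → 𝕜) (m : ℕ) (β : Fin d →₀ ℕ) :
    (∏ i, (∑ j ∈ Finset.range (n + 1), Polynomial.C (c i j) * Polynomial.X ^ a j) ^ β i).coeff m =
      (∏ i, ((β i).factorial : 𝕜)) * (qpoly d n a c m).coeff β := by
  have hterm : ∀ γ : Fin d → Fin (n + 1) → ℕ,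
      (∏ i, ((Nat.multinomial Finset.univ (γ i) : Polynomial 𝕜) *
        ∏ j, (Polynomial.C (c i j.1) * Polynomial.X ^ a j.1) ^ γ i j)) =
      Polynomial.C (∏ i, ((Nat.multinomial Finset.univ (γ i) : 𝕜) * ∏ j, c i j.1 ^ γ i j)) *
        Polynomial.X ^ (∑ j : Fin (n + 1), a j.1 * ∑ i, γ i j) := by
    intro γ
    have hexp : (Polynomial.X : Polynomial 𝕜) ^ (∑ j : Fin (n + 1), a j.1 * ∑ i, γ i j) =
        ∏ i, ∏ j : Fin (n + 1), (Polynomial.X ^ a j.1) ^ γ i j := by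
      simp only [← pow_mul, Finset.prod_pow_eq_pow_sum, Finset.mul_sum]
      rw [Finset.sum_comm]
    rw [hexp]
    simp only [map_prod, map_mul, map_natCast, map_pow, mul_pow, Finset.prod_mul_distrib]
    ring
  simp only [← Fin.sum_univ_eq_sum_range
    (fun j => Polynomial.C (c _ j) * (Polynomial.X : Polynomial 𝕜) ^ a j),
    Finset.sum_pow_eq_sum_piAntidiag, Finset.prod_univ_sum, hterm, Polynomial.finsetSum_coeff,
    Polynomial.coeff_C_mul, Polynomial.coeff_X_pow, mul_ite, mul_one, mul_zero]
  rw [coeff_qpoly, ← Finset.sum_filter, Finset.mul_sum]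
  refine Finset.sum_congr ?_ ?_
  · ext γ
    simp only [Finset.mem_filter, Fintype.mem_piFinset, Finset.mem_piAntidiag, Finset.mem_univ,
      implies_true, and_true, Finset.mem_range]
    constructor
    · rintro ⟨h1, h2⟩
      refine ⟨fun i j => ?_, h2.symm, h1⟩
      rw [Nat.lt_succ_iff, h2]
      calc γ i j ≤ ∑ i, γ i j := Finset.single_le_sum (f := fun i => γ i j) (by simp) (by simp)
        _ ≤ a j.1 * ∑ i, γ i j := Nat.le_mul_of_pos_left _ (ha _ (Nat.lt_succ_iff.mp j.2))
        _ ≤ _ := Finset.single_le_sum (f := fun j : Fin (n + 1) => a j.1 * ∑ i, γ i j)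
            (by simp) (Finset.mem_univ j)
    · rintro ⟨-, h2, h1⟩
      exact ⟨h1, h2.symm⟩
  · intro γ hγ
    have hβ : ∀ i, ∑ j, γ i j = β i := (Finset.mem_filter.mp hγ).2.2
    have hne : ((∏ i, ∏ j, Nat.factorial (γ i j) : ℕ) : 𝕜) ≠ 0 := by
      exact_mod_cast Finset.prod_ne_zero_iff.mpr fun i _ =>
        Finset.prod_ne_zero_iff.mpr fun j _ => Nat.factorial_ne_zero _
    have hfac : (∏ i, ((β i).factorial : 𝕜)) =
        ((∏ i, ∏ j, Nat.factorial (γ i j) : ℕ) : 𝕜) *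
          ∏ i, (Nat.multinomial Finset.univ (γ i) : 𝕜) := by
      rw [← Nat.cast_prod, ← Nat.cast_prod, ← Nat.cast_mul, ← Finset.prod_mul_distrib]
      simp only [Nat.multinomial_spec, hβ]
    rw [hfac, Finset.prod_mul_distrib]
    field_simp

/-- The restriction of `f` to the curve `t ↦ ξ + φ t`, as a polynomial in `t`. -/
noncomputable def curvePoly {𝕜 : Type*} [CommRing 𝕜] {d : ℕ} (n : ℕ) (a : ℕ → ℕ)
    (c : Fin d → ℕ → 𝕜) (ξ : Fin d → 𝕜) (f : MvPolynomial (Fin d) 𝕜) : Polynomial 𝕜 :=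
  aeval (fun i => ∑ j ∈ Finset.range (n + 1), Polynomial.C (c i j) * Polynomial.X ^ a j)
    (affineSubst ξ (fun i => Pi.single i 1) f)

theorem eval_curvePoly {𝕜 : Type*} [CommRing 𝕜] {d : ℕ} (n : ℕ) (a : ℕ → ℕ)
    (c : Fin d → ℕ → 𝕜) (ξ : Fin d → 𝕜) (f : MvPolynomial (Fin d) 𝕜) (t : 𝕜) :
    (curvePoly n a c ξ f).eval t =
      eval (fun i => ξ i + ∑ j ∈ Finset.range (n + 1), c i j * t ^ a j) f := by
  have h : ∀ F : MvPolynomial (Fin d) 𝕜,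
      (aeval (fun i => ∑ j ∈ Finset.range (n + 1),
        Polynomial.C (c i j) * Polynomial.X ^ a j) F).eval t =
      eval (fun i => ∑ j ∈ Finset.range (n + 1), c i j * t ^ a j) F := by
    intro F
    induction F using MvPolynomial.induction_on with
    | C a => simp
    | add p q hp hq => simp [hp, hq]
    | mul_X p j hp => simp [hp, Polynomial.eval_finsetSum]
  rw [curvePoly, h, eval_affineSubst]
  congr 2
  ext i
  simp [Pi.single_apply]

theorem eval_DMulti {𝕜 : Type*} [RCLike 𝕜] {d : ℕ} (ξ : Fin d → 𝕜) (β : Fin d →₀ ℕ)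
    (f : MvPolynomial (Fin d) 𝕜) :
    eval ξ (DMulti (fun i => β i) f) = (∏ i, ((β i).factorial : 𝕜)) *
      (affineSubst ξ (fun i => Pi.single i 1) f).coeff β := by
  have hD : DMulti (fun i => β i) =
      dirDerivMulti (fun i => (Pi.single i 1 : Fin d → 𝕜)) (fun i => β i) := by
    have : ∀ i, dirDeriv (Pi.single i 1 : Fin d → 𝕜) = (pderiv i).toLinearMap := by
      intro i
      ext1 f
      simp [dirDeriv, Pi.single_apply]
    simp only [DMulti, dirDerivMulti, this]
  rw [hD, eval_dirDerivMulti]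
  congr 2
  ext i
  rfl

theorem eval_polyD_qpoly {𝕜 : Type*} [RCLike 𝕜] {d n : ℕ} {a : ℕ → ℕ}
    (ha : ∀ j ≤ n, 1 ≤ a j) (c : Fin d → ℕ → 𝕜) (ξ : Fin d → 𝕜) (m : ℕ)
    (f : MvPolynomial (Fin d) 𝕜) :
    eval ξ (polyD (qpoly d n a c m) f) = (curvePoly n a c ξ f).coeff m := by
  classical
  set F := affineSubst ξ (fun i => Pi.single i 1) f with hF
  set q := qpoly d n a c m with hq
  have hl : eval ξ (polyD q f) =
      ∑ β ∈ q.support ∪ F.support, q.coeff β * ((∏ i, ((β i).factorial : 𝕜)) * F.coeff β) := by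
    rw [← Finset.sum_subset (Finset.subset_union_left (s₁ := q.support))]
    · simp [polyD, LinearMap.sum_apply, smul_eval, eval_DMulti, hF]
    · intro β _ h
      simp [notMem_support_iff.mp h]
  have hr : (curvePoly n a c ξ f).coeff m =
      ∑ β ∈ q.support ∪ F.support, q.coeff β * ((∏ i, ((β i).factorial : 𝕜)) * F.coeff β) := by
    rw [← Finset.sum_subset (Finset.subset_union_right (s₂ := F.support))]
    · rw [curvePoly, ← hF, aeval_def, eval₂_eq', Polynomial.finsetSum_coeff]
      refine Finset.sum_congr rfl fun β _ => ?_
      rw [Polynomial.algebraMap_eq, Polynomial.coeff_C_mul, coeff_curve_prod_pow ha]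
      ring
    · intro β _ h
      simp [notMem_support_iff.mp h]
  rw [hl, hr]

theorem tendsto_polyD_qpoly {𝕜 : Type*} [RCLike 𝕜] {d n : ℕ} {a : ℕ → ℕ}
    (ha : ∀ j ≤ n, 1 ≤ a j) (c : Fin d → ℕ → 𝕜) (ξ : Fin d → 𝕜) (m : ℕ)
    (f : MvPolynomial (Fin d) 𝕜) :
    Filter.Tendsto (fun h : 𝕜 => (h ^ m)⁻¹ *
        ∑ k ∈ Finset.range (m + 1), fwdWeight 𝕜 m k *
          eval (fun i => ξ i
            + ∑ j ∈ Finset.range (n + 1), c i j * ((k : 𝕜) * h) ^ a j) f)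
      (nhdsWithin 0 {0}ᶜ) (nhds (m.factorial * eval ξ (polyD (qpoly d n a c m) f))) := by
  simpa only [eval_curvePoly, ← eval_polyD_qpoly ha c ξ m f] using
    (curvePoly n a c ξ f).tendsto_fwdWeight_sum m

theorem tendsto_zero_of_tendsto_injective {𝕜 ι κ X : Type*} [RCLike 𝕜] [Fintype ι] [Fintype κ]
    {l : Filter X} (T : (ι → 𝕜) →ₗ[𝕜] (κ → 𝕜)) (hT : Function.Injective T)
    (S : X → (ι → 𝕜) →ₗ[𝕜] (κ → 𝕜))
    (hS : ∀ v, Filter.Tendsto (fun x => S x v) l (nhds (T v)))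
    (u : X → ι → 𝕜) (hu : Filter.Tendsto (fun x => S x (u x)) l (nhds 0)) :
    Filter.Tendsto u l (nhds 0) := by
  classical
  obtain ⟨K, hK, hanti⟩ := T.injective_iff_antilipschitz.mp hT
  have hbound : ∀ v, ‖v‖ ≤ K * ‖T v‖ := fun v => by
    simpa [dist_eq_norm] using hanti.le_mul_dist v 0
  set ε : X → ℝ := fun x => ∑ i, ‖S x (Pi.single i 1) - T (Pi.single i 1)‖
  have hε : Filter.Tendsto ε l (nhds 0) := by
    have : Filter.Tendsto ε l (nhds (∑ _i : ι, (0 : ℝ))) :=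
      tendsto_finsetSum _ fun i _ => tendsto_iff_norm_sub_tendsto_zero.mp (hS _)
    simpa using this
  have hdiff : ∀ x v, ‖S x v - T v‖ ≤ ‖v‖ * ε x := by
    intro x v
    have : S x v - T v = ∑ i, v i • (S x (Pi.single i 1) - T (Pi.single i 1)) := by
      conv_lhs => rw [pi_eq_sum_univ' v]
      simp only [map_sum, map_smul, ← Finset.sum_sub_distrib, ← smul_sub]
    rw [this, Finset.mul_sum]
    refine (norm_sum_le _ _).trans (Finset.sum_le_sum fun i _ => ?_)
    rw [norm_smul]
    exact mul_le_mul_of_nonneg_right (norm_le_pi_norm v i) (norm_nonneg _)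
  have hK0 : (0 : ℝ) < K := hK
  have hsmall : ∀ᶠ x in l, ‖u x‖ ≤ 2 * K * ‖S x (u x)‖ := by
    filter_upwards [hε.eventually (ge_mem_nhds (show (0 : ℝ) < 1 / (2 * K) by positivity))]
      with x hx
    have h1 := hbound (u x)
    have h2 : ‖T (u x)‖ ≤ ‖S x (u x)‖ + ‖S x (u x) - T (u x)‖ := by
      have := norm_sub_le (S x (u x)) (S x (u x) - T (u x))
      simpa using this
    have h3 : K * (‖u x‖ * ε x) ≤ ‖u x‖ / 2 := by
      calc K * (‖u x‖ * ε x) ≤ K * (‖u x‖ * (1 / (2 * K))) := by gcongr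
        _ = ‖u x‖ / 2 := by field_simp
    have h4 : K * ‖T (u x)‖ ≤ K * (‖S x (u x)‖ + ‖S x (u x) - T (u x)‖) := by gcongr
    have h5 : K * ‖S x (u x) - T (u x)‖ ≤ K * (‖u x‖ * ε x) := by
      gcongr
      exact hdiff x (u x)
    linarith
  refine squeeze_zero_norm' hsmall ?_
  simpa using hu.norm.const_mul (2 * (K : ℝ))

/-- If functionals `S x` converge pointwise to functionals `T` that separate the points of a
finite-dimensional space `V`, then elements of `V` on which the `S x` tend to zero tend to zero
coefficientwise. -/
theorem MvPolynomial.tendsto_coeff_zero {𝕜 σ κ X : Type*} [RCLike 𝕜] [Fintype κ]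
    {l : Filter X} (V : Submodule 𝕜 (MvPolynomial σ 𝕜)) [FiniteDimensional 𝕜 V]
    (T : κ → MvPolynomial σ 𝕜 →ₗ[𝕜] 𝕜) (hT : ∀ v ∈ V, (∀ k, T k v = 0) → v = 0)
    (S : X → κ → MvPolynomial σ 𝕜 →ₗ[𝕜] 𝕜)
    (hS : ∀ k v, Filter.Tendsto (fun x => S x k v) l (nhds (T k v)))
    (u : X → MvPolynomial σ 𝕜) (huV : ∀ᶠ x in l, u x ∈ V)
    (hu : ∀ k, Filter.Tendsto (fun x => S x k (u x)) l (nhds 0)) (β : σ →₀ ℕ) :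
    Filter.Tendsto (fun x => coeff β (u x)) l (nhds 0) := by
  classical
  set b := Module.finBasis 𝕜 V
  let e : (Fin (Module.finrank 𝕜 V) → 𝕜) →ₗ[𝕜] MvPolynomial σ 𝕜 :=
    V.subtype ∘ₗ b.equivFun.symm.toLinearMap
  have heV : ∀ y, e y ∈ V := fun y => (b.equivFun.symm y).2
  have he : Function.Injective e :=
    V.injective_subtype.comp b.equivFun.symm.injective
  let w : X → Fin (Module.finrank 𝕜 V) → 𝕜 := fun x =>
    if h : u x ∈ V then b.equivFun ⟨u x, h⟩ else 0
  have hw : ∀ᶠ x in l, e (w x) = u x := by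
    filter_upwards [huV] with x hx
    simp [e, w, hx]
  have hw0 : Filter.Tendsto w l (nhds 0) := by
    refine tendsto_zero_of_tendsto_injective ((LinearMap.pi T) ∘ₗ e) ?_
      (fun x => (LinearMap.pi (S x)) ∘ₗ e) ?_ w ?_
    · rw [← LinearMap.ker_eq_bot, LinearMap.ker_eq_bot']
      intro y hy
      refine (map_eq_zero_iff e he).mp (hT _ (heV y) fun k => ?_)
      simpa using congrFun hy k
    · exact fun v => tendsto_pi_nhds.mpr fun k => hS k (e v)
    · refine tendsto_pi_nhds.mpr fun k => (hu k).congr' ?_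
      filter_upwards [hw] with x hx
      simp [hx]
  have hcont : Continuous ((lcoeff 𝕜 β) ∘ₗ e) := LinearMap.continuous_of_finiteDimensional _
  have := (hcont.tendsto 0).comp hw0
  rw [map_zero] at this
  refine this.congr' ?_
  filter_upwards [hw] with x hx
  simp [hx]

/-- with the Hermite interpolation operator `P` (interpolating the
functionals `f ↦ (D_{ρ^{(k)}}^α f)(ξ^{(k)})` and `f ↦ (q^{(l)}_{n(l),m}(D) f)(ξ^{(μ+l)})`
from `V`) and the Lagrange interpolation operators `P_h` at the perturbed points
(`0 < |h| < η`), `P` is the pointwise limit of `P_h` as `h → 0`: every coefficient of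
`P_h f` tends to the corresponding coefficient of `P f`. -/
theorem hermite_is_pointwise_limit_of_lagrange {𝕜 : Type*} [RCLike 𝕜]
    (d μ ν : ℕ) (hd : 1 ≤ d)
    (ξ : Fin (μ + ν) → (Fin d → 𝕜)) (hξ : Function.Injective ξ)
    (Δ : Fin μ → Finset (Fin d → ℕ))
    (hΔ : ∀ k, ∀ α ∈ Δ k, ∀ β : Fin d → ℕ, (∀ i, β i ≤ α i) → β ∈ Δ k)
    (ρ : Fin μ → Fin d → (Fin d → 𝕜)) (hρ : ∀ k, LinearIndependent 𝕜 (ρ k))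
    (nl : Fin ν → ℕ) (hnl : ∀ l, 1 ≤ nl l)
    (a : Fin ν → ℕ → ℕ) (ha0 : ∀ l, a l 0 = 1)
    (hadec : ∀ l j, 1 ≤ j → j < nl l → a l (j + 1) < a l j)
    (han : ∀ l, 2 ≤ a l (nl l))
    (c : Fin ν → Fin d → ℕ → 𝕜) (hc : ∀ l, ∃ i, c l i 0 ≠ 0)
    (V : Submodule 𝕜 (MvPolynomial (Fin d) 𝕜)) (hV : FiniteDimensional 𝕜 V)
    (hHermite : ∀ f : MvPolynomial (Fin d) 𝕜, ∃! g : MvPolynomial (Fin d) 𝕜,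
      g ∈ V ∧
      (∀ k : Fin μ, ∀ α ∈ Δ k,
        eval (ξ (Fin.castAdd ν k)) (dirDerivMulti (ρ k) α g)
          = eval (ξ (Fin.castAdd ν k)) (dirDerivMulti (ρ k) α f)) ∧
      (∀ l : Fin ν, ∀ m ≤ a l 1,
        eval (ξ (Fin.natAdd μ l)) (polyD (qpoly d (nl l) (a l) (c l) m) g)
          = eval (ξ (Fin.natAdd μ l)) (polyD (qpoly d (nl l) (a l) (c l) m) f)))
    (η : ℝ) (hη : 0 < η)
    (hLagrange : ∀ h : 𝕜, 0 < ‖h‖ → ‖h‖ < η →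
      ∀ f : MvPolynomial (Fin d) 𝕜, ∃! g : MvPolynomial (Fin d) 𝕜,
        g ∈ V ∧
        (∀ k : Fin μ, ∀ α ∈ Δ k,
          eval (fun j => ξ (Fin.castAdd ν k) j + h * ∑ i, (α i : 𝕜) * ρ k i j) g
            = eval (fun j => ξ (Fin.castAdd ν k) j + h * ∑ i, (α i : 𝕜) * ρ k i j) f) ∧
        (∀ l : Fin ν, ∀ m ≤ a l 1,
          eval (fun i => ξ (Fin.natAdd μ l) i
              + ∑ j ∈ Finset.range (nl l + 1), c l i j * ((m : 𝕜) * h) ^ a l j) g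
            = eval (fun i => ξ (Fin.natAdd μ l) i
              + ∑ j ∈ Finset.range (nl l + 1), c l i j * ((m : 𝕜) * h) ^ a l j) f))
    (P : MvPolynomial (Fin d) 𝕜 → MvPolynomial (Fin d) 𝕜)
    (hP : ∀ f : MvPolynomial (Fin d) 𝕜,
      P f ∈ V ∧
      (∀ k : Fin μ, ∀ α ∈ Δ k,
        eval (ξ (Fin.castAdd ν k)) (dirDerivMulti (ρ k) α (P f))
          = eval (ξ (Fin.castAdd ν k)) (dirDerivMulti (ρ k) α f)) ∧
      (∀ l : Fin ν, ∀ m ≤ a l 1,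
        eval (ξ (Fin.natAdd μ l)) (polyD (qpoly d (nl l) (a l) (c l) m) (P f))
          = eval (ξ (Fin.natAdd μ l)) (polyD (qpoly d (nl l) (a l) (c l) m) f)))
    (Ph : 𝕜 → MvPolynomial (Fin d) 𝕜 → MvPolynomial (Fin d) 𝕜)
    (hPh : ∀ h : 𝕜, 0 < ‖h‖ → ‖h‖ < η → ∀ f : MvPolynomial (Fin d) 𝕜,
      Ph h f ∈ V ∧
      (∀ k : Fin μ, ∀ α ∈ Δ k,
        eval (fun j => ξ (Fin.castAdd ν k) j + h * ∑ i, (α i : 𝕜) * ρ k i j) (Ph h f)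
          = eval (fun j => ξ (Fin.castAdd ν k) j + h * ∑ i, (α i : 𝕜) * ρ k i j) f) ∧
      (∀ l : Fin ν, ∀ m ≤ a l 1,
        eval (fun i => ξ (Fin.natAdd μ l) i
            + ∑ j ∈ Finset.range (nl l + 1), c l i j * ((m : 𝕜) * h) ^ a l j) (Ph h f)
          = eval (fun i => ξ (Fin.natAdd μ l) i
            + ∑ j ∈ Finset.range (nl l + 1), c l i j * ((m : 𝕜) * h) ^ a l j) f)) :
    ∀ f : MvPolynomial (Fin d) 𝕜, ∀ β : Fin d →₀ ℕ,
      Filter.Tendsto (fun h : 𝕜 => MvPolynomial.coeff β (Ph h f))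
        (nhdsWithin 0 {h : 𝕜 | 0 < ‖h‖ ∧ ‖h‖ < η})
        (nhds (MvPolynomial.coeff β (P f))) := by
  intro f β
  set l := nhdsWithin (0 : 𝕜) {h : 𝕜 | 0 < ‖h‖ ∧ ‖h‖ < η}
  have hl : l ≤ nhdsWithin 0 {0}ᶜ := nhdsWithin_mono 0 fun h hh => norm_pos_iff.mp hh.1
  have hmem : ∀ᶠ h in l, 0 < ‖h‖ ∧ ‖h‖ < η := self_mem_nhdsWithin
  have ha : ∀ l j, j ≤ nl l → 1 ≤ a l j := by
    intro l j hj
    rcases Nat.eq_zero_or_pos j with rfl | hj0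
    · exact (ha0 l).ge
    · have : 2 ≤ a l j := Nat.decreasingInduction'
        (P := fun j => 2 ≤ a l j)
        (fun k hk hjk ih => ih.trans (hadec l k (hj0.trans_le hjk) hk).le) hj (han l)
      omega
  let T : (Σ k : Fin μ, Δ k) ⊕ (Σ l : Fin ν, Fin (a l 1 + 1)) → MvPolynomial (Fin d) 𝕜 →ₗ[𝕜] 𝕜 :=
    Sum.elim
      (fun s => (aeval (ξ (Fin.castAdd ν s.1))).toLinearMap ∘ₗ dirDerivMulti (ρ s.1) s.2.1)
      (fun s => (s.2.1.factorial : 𝕜) • ((aeval (ξ (Fin.natAdd μ s.1))).toLinearMap ∘ₗ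
        polyD (qpoly d (nl s.1) (a s.1) (c s.1) s.2.1)))
  let S : 𝕜 → (Σ k : Fin μ, Δ k) ⊕ (Σ l : Fin ν, Fin (a l 1 + 1)) →
      MvPolynomial (Fin d) 𝕜 →ₗ[𝕜] 𝕜 := fun h =>
    Sum.elim
      (fun s => (h ^ (∑ i, s.2.1 i))⁻¹ •
        ∑ β ∈ Fintype.piFinset fun i => Finset.range (s.2.1 i + 1),
          (∏ i, fwdWeight 𝕜 (s.2.1 i) (β i)) • (aeval fun j =>
            ξ (Fin.castAdd ν s.1) j + h * ∑ i, (β i : 𝕜) * ρ s.1 i j).toLinearMap)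
      (fun s => (h ^ s.2.1)⁻¹ • ∑ k ∈ Finset.range (s.2.1 + 1), fwdWeight 𝕜 s.2.1 k •
        (aeval fun i => ξ (Fin.natAdd μ s.1) i + ∑ j ∈ Finset.range (nl s.1 + 1),
          c s.1 i j * ((k : 𝕜) * h) ^ a s.1 j).toLinearMap)
  have hST : ∀ k v, Filter.Tendsto (fun h => S h k v) l (nhds (T k v)) := by
    rintro (s | s) v
    · simpa [S, T, LinearMap.sum_apply, aeval_eq_eval] using
        (tendsto_dirDerivMulti (ξ (Fin.castAdd ν s.1)) (ρ s.1) s.2.1 v).mono_left hl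
    · simpa [S, T, LinearMap.sum_apply, aeval_eq_eval] using
        (tendsto_polyD_qpoly (ha s.1) (c s.1) (ξ (Fin.natAdd μ s.1)) s.2.1 v).mono_left hl
  have hSeq : ∀ᶠ h in l, ∀ k, S h k (Ph h f) = S h k f := by
    filter_upwards [hmem] with h hh
    obtain ⟨-, h1, h2⟩ := hPh h hh.1 hh.2 f
    rintro (s | s)
    · simp only [S, Sum.elim_inl, LinearMap.smul_apply, LinearMap.sum_apply,
        AlgHom.toLinearMap_apply, aeval_eq_eval]
      refine congrArg _ (Finset.sum_congr rfl fun β hβ => congrArg _ (h1 _ _ ?_))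
      exact hΔ _ _ s.2.2 _ fun i =>
        Nat.lt_succ_iff.mp (Finset.mem_range.mp (Fintype.mem_piFinset.mp hβ i))
    · simp only [S, Sum.elim_inr, LinearMap.smul_apply, LinearMap.sum_apply,
        AlgHom.toLinearMap_apply, aeval_eq_eval]
      refine congrArg _ (Finset.sum_congr rfl fun k hk => congrArg _ (h2 _ _ ?_))
      have h3 := Finset.mem_range.mp hk
      have h4 := s.2.2
      omega
  obtain ⟨hPV, hP1, hP2⟩ := hP f
  have hTP : ∀ k, T k (P f) = T k f := by
    rintro (s | s)
    · simpa [T, aeval_eq_eval] using hP1 s.1 s.2.1 s.2.2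
    · simp [T, aeval_eq_eval, hP2 s.1 s.2.1 (Nat.lt_succ_iff.mp s.2.2)]
  have hTinj : ∀ v ∈ V, (∀ k, T k v = 0) → v = 0 := by
    intro v hv hTv
    refine (hHermite 0).unique ⟨hv, fun k α hα => ?_, fun l m hm => ?_⟩
      ⟨V.zero_mem, fun _ _ _ => rfl, fun _ _ _ => rfl⟩
    · simpa [T, aeval_eq_eval] using hTv (Sum.inl ⟨k, α, hα⟩)
    · simpa [T, aeval_eq_eval, Nat.factorial_ne_zero] using
        hTv (Sum.inr ⟨l, m, Nat.lt_succ_iff.mpr hm⟩)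
  have hlim := MvPolynomial.tendsto_coeff_zero V T hTinj S hST (fun h => Ph h f - P f)
    (by
      filter_upwards [hmem] with h hh
      exact V.sub_mem (hPh h hh.1 hh.2 f).1 hPV)
    (fun k => by
      have h0 := (hST k f).sub (hST k (P f))
      rw [hTP, sub_self] at h0
      refine h0.congr' ?_
      filter_upwards [hSeq] with h hh
      rw [map_sub, hh k]) β
  simpa using hlim.add_const (coeff β (P f))
end
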